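/- Let e ≥ 10 and 5 ≤ n ≤ e−4 be integers. The defining toric ideal I_{S(e,1,n)} of the numerical semigroup S(e,1,n) inside R(e,1,n) = K[x_i : i ∈ {0, 2, 3, …, e−1} \ {n}] is generated, minimally, by the set G = J ∪ K ∪ L, where J = {x_i x_{j+1} − x_{i+1} x_j : i < j, i, j ∈ {2,…,e−2} \ {n−1, n}} ∪ {x_0^2 x_i − x_{i+1} x_{e−1} : i ∈ {2,…,e−2} \ {n−1, n}}, K = {x_0 x_{i+2} − x_2 x_i : i ∈ {2,…,e−3} \ {n−2, n}} ∪ {x_0^3 − x_2 x_{e−2}}, and L = {x_{n+1} x_{n+1+i} − x_{n−1} x_{n+3+i} : 0 ≤ i ≤ e−n−4} ∪ {x_{n−1} x_{n−1−i} − x_{n+1} x_{n−3−i} : 0 ≤ i ≤ n−5} ∪ {x_{n−1} x_3 − x_{n+2} x_0} ∪ {x_0^2 x_{n−1} − x_{n+1} x_{e−2}, x_0 x_2 x_{n−2} − x_{n+1} x_{e−1}}. -/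

import Mathlib

open MvPolynomial

/-- Index set of the polynomial ring `R(e,m,n)`: indices `i ∈ {0,…,e−1} \ {m,n}`. -/
abbrev SallyIdx (e m n : ℕ) : Type := {i : ℕ // i < e ∧ i ≠ m ∧ i ≠ n}

/-- The variable `x_i` of `R(e,m,n)` (and `0` for an invalid index). -/
noncomputable def sX (e m n : ℕ) (i : ℕ) : MvPolynomial (SallyIdx e m n) ℚ :=
  if h : i < e ∧ i ≠ m ∧ i ≠ n then MvPolynomial.X ⟨i, h⟩ else 0

/-- The defining toric ideal `I_{S(e,m,n)}`: the kernel of the `ℚ`-algebra homomorphism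
`R(e,m,n) → ℚ[t]` sending `x_i ↦ t^{e+i}`. -/
noncomputable def sallyIdeal (e m n : ℕ) : Ideal (MvPolynomial (SallyIdx e m n) ℚ) :=
  RingHom.ker (MvPolynomial.aeval
    (fun i : SallyIdx e m n => (Polynomial.X : Polynomial ℚ) ^ (e + i.1))).toRingHom

/-- The generating set `G = J ∪ K ∪ L` for `I_{S(e,1,n)}`, `5 ≤ n ≤ e−4`. -/
noncomputable def genSet (e n : ℕ) : Set (MvPolynomial (SallyIdx e 1 n) ℚ) :=
  -- J
  {p | ∃ i j : ℕ, (2 ≤ i ∧ i ≤ e - 2 ∧ i ≠ n - 1 ∧ i ≠ n) ∧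
      (2 ≤ j ∧ j ≤ e - 2 ∧ j ≠ n - 1 ∧ j ≠ n) ∧ i < j ∧
      p = sX e 1 n i * sX e 1 n (j+1) - sX e 1 n (i+1) * sX e 1 n j} ∪
  {p | ∃ i : ℕ, (2 ≤ i ∧ i ≤ e - 2 ∧ i ≠ n - 1 ∧ i ≠ n) ∧
      p = sX e 1 n 0 ^ 2 * sX e 1 n i - sX e 1 n (i+1) * sX e 1 n (e-1)} ∪
  -- K
  {p | ∃ i : ℕ, (2 ≤ i ∧ i ≤ e - 3 ∧ i ≠ n - 2 ∧ i ≠ n) ∧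
      p = sX e 1 n 0 * sX e 1 n (i+2) - sX e 1 n 2 * sX e 1 n i} ∪
  {sX e 1 n 0 ^ 3 - sX e 1 n 2 * sX e 1 n (e-2)} ∪
  -- L
  {p | ∃ i : ℕ, i ≤ e - n - 4 ∧
      p = sX e 1 n (n+1) * sX e 1 n (n+1+i) - sX e 1 n (n-1) * sX e 1 n (n+3+i)} ∪
  {p | ∃ i : ℕ, i ≤ n - 5 ∧
      p = sX e 1 n (n-1) * sX e 1 n (n-1-i) - sX e 1 n (n+1) * sX e 1 n (n-3-i)} ∪
  {sX e 1 n (n-1) * sX e 1 n 3 - sX e 1 n (n+2) * sX e 1 n 0} ∪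
  {sX e 1 n 0 ^ 2 * sX e 1 n (n-1) - sX e 1 n (n+1) * sX e 1 n (e-2),
   sX e 1 n 0 * sX e 1 n 2 * sX e 1 n (n-2) - sX e 1 n (n+1) * sX e 1 n (e-1)}

/-- The relations which the generators in `genSet e n` impose on a family `y` of ring elements. -/
structure SallyRel {A : Type*} [CommRing A] (e n : ℕ) (y : ℕ → A) : Prop where
  inward : ∀ i j, (2 ≤ i ∧ i ≤ e - 2 ∧ i ≠ n - 1 ∧ i ≠ n) →
    (2 ≤ j ∧ j ≤ e - 2 ∧ j ≠ n - 1 ∧ j ≠ n) → i < j → y i * y (j + 1) = y (i + 1) * y j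
  high : ∀ i, (2 ≤ i ∧ i ≤ e - 2 ∧ i ≠ n - 1 ∧ i ≠ n) → y 0 ^ 2 * y i = y (i + 1) * y (e - 1)
  low : ∀ i, (2 ≤ i ∧ i ≤ e - 3 ∧ i ≠ n - 2 ∧ i ≠ n) → y 0 * y (i + 2) = y 2 * y i
  cube : y 0 ^ 3 = y 2 * y (e - 2)
  jump_right : ∀ i, i ≤ e - n - 4 → y (n + 1) * y (n + 1 + i) = y (n - 1) * y (n + 3 + i)
  jump_left : ∀ i, i ≤ n - 5 → y (n - 1) * y (n - 1 - i) = y (n + 1) * y (n - 3 - i)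
  low_gap : y (n - 1) * y 3 = y (n + 2) * y 0
  high_gap : y 0 ^ 2 * y (n - 1) = y (n + 1) * y (e - 2)
  high_top : y 0 * y 2 * y (n - 2) = y (n + 1) * y (e - 1)

namespace SallyRel

variable {A : Type*} [CommRing A] {e n : ℕ} {y : ℕ → A}

lemma mul_eq_mul_inner (h : SallyRel e n y) (hn5 : 5 ≤ n) (hne : n + 4 ≤ e) (k : ℕ) :
    ∀ a b a' b', a' = a + k → b = b' + k → 2 ≤ a → a' ≤ b' → b < e → a ≠ n → b ≠ n →
      a' ≠ n → b' ≠ n → y a * y b = y a' * y b' := by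
  induction k using Nat.strong_induction_on with
  | _ k ih =>
    intro a b a' b' ha' hb ha hab hbe han hbn ha'n hb'n
    rcases Nat.eq_zero_or_pos k with rfl | hk
    · simp only [Nat.add_zero] at ha' hb
      rw [ha', hb]
    by_cases h1 : a + 1 = n
    · have := h.jump_right (b - n - 3) (by omega)
      rw [show n + 1 + (b - n - 3) = b - 2 by omega, show n + 3 + (b - n - 3) = b by omega,
        show n - 1 = a by omega] at this
      rw [← this]
      exact ih (k - 2) (by omega) _ _ _ _ (by omega) (by omega) (by omega) hab (by omega)
        (by omega) (by omega) ha'n hb'n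
    by_cases h2 : b = n + 1
    · have := h.jump_left (n - 3 - a) (by omega)
      rw [show n - 1 - (n - 3 - a) = a + 2 by omega, show n - 3 - (n - 3 - a) = a by omega,
        ← h2] at this
      rw [mul_comm, ← this, mul_comm]
      exact ih (k - 2) (by omega) _ _ _ _ (by omega) (by omega) (by omega) hab (by omega)
        (by omega) (by omega) ha'n hb'n
    have := h.inward a (b - 1) (by omega) (by omega) (by omega)
    rw [show b - 1 + 1 = b by omega] at this
    rw [this]
    exact ih (k - 1) (by omega) _ _ _ _ (by omega) (by omega) (by omega) hab (by omega)
      (by omega) (by omega) ha'n hb'n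

lemma mul_eq_mul (h : SallyRel e n y) (hn5 : 5 ≤ n) (hne : n + 4 ≤ e) {a b c d : ℕ}
    (ha : 2 ≤ a ∧ a < e ∧ a ≠ n) (hb : 2 ≤ b ∧ b < e ∧ b ≠ n)
    (hc : 2 ≤ c ∧ c < e ∧ c ≠ n) (hd : 2 ≤ d ∧ d < e ∧ d ≠ n) (hs : a + b = c + d) :
    y a * y b = y c * y d := by
  wlog hab : a ≤ b generalizing a b
  · rw [mul_comm]
    exact this hb ha (by omega) (by omega)
  wlog hcd : c ≤ d generalizing c d
  · rw [mul_comm (y c)]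
    exact this hd hc (by omega) (by omega)
  rcases le_total a c with hac | hac
  · exact h.mul_eq_mul_inner hn5 hne (c - a) a b c d (by omega) (by omega) ha.1 hcd hb.2.1
      ha.2.2 hb.2.2 hc.2.2 hd.2.2
  · exact (h.mul_eq_mul_inner hn5 hne (a - c) c d a b (by omega) (by omega) hc.1 hab hd.2.1
      hc.2.2 hd.2.2 ha.2.2 hb.2.2).symm

lemma mul_of_lt (h : SallyRel e n y) (hn5 : 5 ≤ n) (hne : n + 4 ≤ e) {i j : ℕ}
    (hi : 2 ≤ i ∧ i < e ∧ i ≠ n) (hj : 2 ≤ j ∧ j < e ∧ j ≠ n)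
    (hs : i + j < e) (hsn : i + j ≠ n) : y i * y j = y 0 * y (i + j) := by
  by_cases h2 : i + j = n + 2
  · rw [h2, mul_comm (y 0), ← h.low_gap]
    exact h.mul_eq_mul hn5 hne hi hj (by omega) (by omega) (by omega)
  · have := h.low (i + j - 2) (by omega)
    rw [show i + j - 2 + 2 = i + j by omega] at this
    rw [this]
    exact h.mul_eq_mul hn5 hne hi hj (by omega) (by omega) (by omega)

lemma mul_of_eq (h : SallyRel e n y) (hn5 : 5 ≤ n) (hne : n + 4 ≤ e) {i j : ℕ}
    (hi : 2 ≤ i ∧ i < e ∧ i ≠ n) (hj : 2 ≤ j ∧ j < e ∧ j ≠ n)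
    (hs : i + j = e) : y i * y j = y 0 ^ 3 := by
  rw [h.cube]
  exact h.mul_eq_mul hn5 hne hi hj (by omega) (by omega) (by omega)

lemma mul_of_gt (h : SallyRel e n y) (hn5 : 5 ≤ n) (hne : n + 4 ≤ e) {i j : ℕ}
    (hi : 2 ≤ i ∧ i < e ∧ i ≠ n) (hj : 2 ≤ j ∧ j < e ∧ j ≠ n)
    (hs : e + 1 < i + j) (hsn : i + j ≠ e + n) :
    y i * y j = y 0 ^ 2 * y (i + j - e) := by
  by_cases h2 : i + j - e = n - 1
  · rw [h2, h.high_gap]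
    exact h.mul_eq_mul hn5 hne hi hj (by omega) (by omega) (by omega)
  · rw [h.high _ (by omega)]
    exact h.mul_eq_mul hn5 hne hi hj (by omega) (by omega) (by omega)

lemma mul_of_eq_add (h : SallyRel e n y) (hn5 : 5 ≤ n) (hne : n + 4 ≤ e) {i j : ℕ}
    (hi : 2 ≤ i ∧ i < e ∧ i ≠ n) (hj : 2 ≤ j ∧ j < e ∧ j ≠ n)
    (hs : i + j = e + n) : y i * y j = y 0 * (y 2 * y (n - 2)) := by
  rw [← mul_assoc, h.high_top]
  exact h.mul_eq_mul hn5 hne hi hj (by omega) (by omega) (by omega)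

end SallyRel

/-- The monomials of weight `k * e + r` representing the Apéry set of `S(e,1,n)` with respect to
`e`, evaluated at the family `y`. -/
inductive IsApery {A : Type*} [CommRing A] (e n : ℕ) (y : ℕ → A) : ℕ → ℕ → A → Prop
  | one : IsApery e n y 0 0 1
  | var (i : ℕ) (hi : 2 ≤ i ∧ i < e ∧ i ≠ n) : IsApery e n y 1 i (y i)
  | gap : IsApery e n y 2 n (y 2 * y (n - 2))
  | top : IsApery e n y 3 1 (y 2 * y (e - 1))

/-- `p` is a power of `y 0` times an Apéry monomial, of total weight `W`. -/
def IsNormalForm {A : Type*} [CommRing A] (e n : ℕ) (y : ℕ → A) (W : ℕ) (p : A) : Prop :=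
  ∃ a k r q, IsApery e n y k r q ∧ W = (a + k) * e + r ∧ p = y 0 ^ a * q

section NormalForm

variable {A : Type*} [CommRing A] {e n : ℕ} {y : ℕ → A}

lemma IsApery.lt {k r : ℕ} {q : A} (h : IsApery e n y k r q) (hn5 : 5 ≤ n) (hne : n + 4 ≤ e) :
    r < e := by
  cases h <;> omega

lemma IsApery.unique {k k' r : ℕ} {q q' : A} (h : IsApery e n y k r q)
    (h' : IsApery e n y k' r q') (hn5 : 5 ≤ n) : k = k' ∧ q = q' := by
  cases h <;> cases h' <;> first | exact ⟨rfl, rfl⟩ | omega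

lemma IsNormalForm.unique {W : ℕ} {p p' : A} (h : IsNormalForm e n y W p)
    (h' : IsNormalForm e n y W p') (hn5 : 5 ≤ n) (hne : n + 4 ≤ e) : p = p' := by
  obtain ⟨a, k, r, q, hq, rfl, rfl⟩ := h
  obtain ⟨a', k', r', q', hq', hW, rfl⟩ := h'
  have hr := hq.lt hn5 hne
  have hr' := hq'.lt hn5 hne
  have he : 0 < e := by omega
  have h1 := congrArg (· % e) hW
  have h2 := congrArg (· / e) hW
  simp only [Nat.mul_add_mod_self_right, Nat.mod_eq_of_lt hr, Nat.mod_eq_of_lt hr'] at h1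
  subst h1
  simp only [Nat.add_comm _ r, Nat.add_mul_div_right _ _ he, Nat.div_eq_of_lt hr] at h2
  obtain ⟨rfl, rfl⟩ := hq.unique hq' hn5
  rw [show a = a' by omega]

lemma IsApery.isNormalForm {W k r : ℕ} {q : A} (h : IsApery e n y k r q) (hW : W = k * e + r) :
    IsNormalForm e n y W q :=
  ⟨0, k, r, q, h, by simpa using hW, by simp⟩

lemma IsNormalForm.pow_mul {W W' : ℕ} {p : A} (h : IsNormalForm e n y W p) (b : ℕ)
    (hW : W' = b * e + W) : IsNormalForm e n y W' (y 0 ^ b * p) := by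
  obtain ⟨a, k, r, q, hq, rfl, rfl⟩ := h
  exact ⟨b + a, k, r, q, hq, by rw [hW]; ring, by ring⟩

lemma IsNormalForm.zero_mul {W W' : ℕ} {p : A} (h : IsNormalForm e n y W p)
    (hW : W' = e + W) : IsNormalForm e n y W' (y 0 * p) := by
  simpa using h.pow_mul 1 (by simpa using hW)

namespace SallyRel

lemma isNormalForm_mul (h : SallyRel e n y) (hn5 : 5 ≤ n) (hne : n + 4 ≤ e) {i j W : ℕ}
    (hi : i < e ∧ i ≠ 1 ∧ i ≠ n) (hj : j < e ∧ j ≠ 1 ∧ j ≠ n)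
    (hW : W = 2 * e + i + j) : IsNormalForm e n y W (y i * y j) := by
  rcases Nat.eq_zero_or_pos i with rfl | hi0
  · rcases Nat.eq_zero_or_pos j with rfl | hj0
    · rw [← pow_two, ← mul_one (y 0 ^ 2)]
      exact (IsApery.one.isNormalForm rfl).pow_mul 2 (by omega)
    · exact ((IsApery.var j (by omega)).isNormalForm rfl).zero_mul (by omega)
  rcases Nat.eq_zero_or_pos j with rfl | hj0
  · rw [mul_comm]
    exact ((IsApery.var i (by omega)).isNormalForm rfl).zero_mul (by omega)
  have hi' : 2 ≤ i ∧ i < e ∧ i ≠ n := by omega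
  have hj' : 2 ≤ j ∧ j < e ∧ j ≠ n := by omega
  by_cases c1 : i + j = n
  · rw [h.mul_eq_mul hn5 hne hi' hj' (c := 2) (d := n - 2) (by omega) (by omega) (by omega)]
    exact IsApery.gap.isNormalForm (by omega)
  by_cases c2 : i + j < e
  · rw [h.mul_of_lt hn5 hne hi' hj' c2 c1]
    exact ((IsApery.var _ (by omega)).isNormalForm rfl).zero_mul (by omega)
  by_cases c3 : i + j = e
  · rw [h.mul_of_eq hn5 hne hi' hj' c3, ← mul_one (y 0 ^ 3)]
    exact (IsApery.one.isNormalForm rfl).pow_mul 3 (by omega)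
  by_cases c4 : i + j = e + 1
  · rw [h.mul_eq_mul hn5 hne hi' hj' (c := 2) (d := e - 1) (by omega) (by omega) (by omega)]
    exact IsApery.top.isNormalForm (by omega)
  by_cases c5 : i + j = e + n
  · rw [h.mul_of_eq_add hn5 hne hi' hj' c5]
    exact (IsApery.gap.isNormalForm rfl).zero_mul (by omega)
  · rw [h.mul_of_gt hn5 hne hi' hj' (by omega) c5]
    exact ((IsApery.var _ (by omega)).isNormalForm rfl).pow_mul 2 (by omega)

lemma isNormalForm_two_two_mul (h : SallyRel e n y) (hn5 : 5 ≤ n) (hne : n + 4 ≤ e) {j W : ℕ}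
    (hj : j < e ∧ j ≠ 1 ∧ j ≠ n) (hW : W = 3 * e + 4 + j) :
    IsNormalForm e n y W (y 2 * (y 2 * y j)) := by
  rw [← mul_assoc, h.mul_of_lt hn5 hne (i := 2) (j := 2) (by omega) (by omega) (by omega)
    (by omega), mul_assoc]
  exact (h.isNormalForm_mul hn5 hne (by omega) hj rfl).zero_mul (by omega)

lemma isNormalForm_gap_mul (h : SallyRel e n y) (hn5 : 5 ≤ n) (hne : n + 4 ≤ e) {j W : ℕ}
    (hj : j < e ∧ j ≠ 1 ∧ j ≠ n) (hW : W = 3 * e + n + j) :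
    IsNormalForm e n y W (y 2 * (y (n - 2) * y j)) := by
  rcases Nat.eq_zero_or_pos j with rfl | hj0
  · rw [← mul_assoc, mul_comm]
    exact (IsApery.gap.isNormalForm rfl).zero_mul (by omega)
  by_cases hj2 : j = 2
  · rw [hj2, mul_comm (y (n - 2))]
    exact h.isNormalForm_two_two_mul hn5 hne (by omega) (by omega)
  have hi' : 2 ≤ n - 2 ∧ n - 2 < e ∧ n - 2 ≠ n := by omega
  have hj' : 2 ≤ j ∧ j < e ∧ j ≠ n := by omega
  by_cases c2 : n - 2 + j < e
  · rw [h.mul_of_lt hn5 hne hi' hj' c2 (by omega), mul_left_comm]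
    exact (h.isNormalForm_mul hn5 hne (by omega) (by omega) rfl).zero_mul (by omega)
  by_cases c3 : n - 2 + j = e
  · rw [h.mul_of_eq hn5 hne hi' hj' c3, mul_comm]
    exact ((IsApery.var 2 (by omega)).isNormalForm rfl).pow_mul 3 (by omega)
  by_cases c4 : n - 2 + j = e + 1
  · rw [h.mul_eq_mul hn5 hne hi' hj' (c := 2) (d := e - 1) (by omega) (by omega) (by omega)]
    exact h.isNormalForm_two_two_mul hn5 hne (by omega) (by omega)
  · rw [h.mul_of_gt hn5 hne hi' hj' (by omega) (by omega), mul_left_comm]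
    exact (h.isNormalForm_mul hn5 hne (by omega) (by omega) rfl).pow_mul 2 (by omega)

lemma isNormalForm_top_mul (h : SallyRel e n y) (hn5 : 5 ≤ n) (hne : n + 4 ≤ e) {j W : ℕ}
    (hj : j < e ∧ j ≠ 1 ∧ j ≠ n) (hW : W = 4 * e + 1 + j) :
    IsNormalForm e n y W (y 2 * (y (e - 1) * y j)) := by
  rcases Nat.eq_zero_or_pos j with rfl | hj0
  · rw [← mul_assoc, mul_comm]
    exact (IsApery.top.isNormalForm rfl).zero_mul (by omega)
  by_cases hj2 : j = 2
  · rw [hj2, mul_comm (y (e - 1))]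
    exact h.isNormalForm_two_two_mul hn5 hne (by omega) (by omega)
  have hi' : 2 ≤ e - 1 ∧ e - 1 < e ∧ e - 1 ≠ n := by omega
  have hj' : 2 ≤ j ∧ j < e ∧ j ≠ n := by omega
  by_cases c5 : e - 1 + j = e + n
  · rw [h.mul_of_eq_add hn5 hne hi' hj' c5, mul_left_comm]
    exact (h.isNormalForm_two_two_mul hn5 hne (by omega) rfl).zero_mul (by omega)
  · rw [h.mul_of_gt hn5 hne hi' hj' (by omega) c5, mul_left_comm]
    exact (h.isNormalForm_mul hn5 hne (by omega) (by omega) rfl).pow_mul 2 (by omega)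

lemma isNormalForm_mul_var (h : SallyRel e n y) (hn5 : 5 ≤ n) (hne : n + 4 ≤ e) {W j : ℕ} {p : A}
    (hp : IsNormalForm e n y W p) (hj : j < e ∧ j ≠ 1 ∧ j ≠ n) :
    IsNormalForm e n y (W + (e + j)) (p * y j) := by
  obtain ⟨a, k, r, q, hq, rfl, rfl⟩ := hp
  have key : IsNormalForm e n y (k * e + r + (e + j)) (q * y j) := by
    cases hq with
    | one =>
      rw [one_mul]
      rcases Nat.eq_zero_or_pos j with rfl | hj0
      · rw [← mul_one (y 0)]
        exact (IsApery.one.isNormalForm rfl).zero_mul (by omega)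
      · exact (IsApery.var j (by omega)).isNormalForm (by omega)
    | var i hi => exact h.isNormalForm_mul hn5 hne (by omega) hj (by omega)
    | gap =>
      rw [mul_assoc]
      exact h.isNormalForm_gap_mul hn5 hne hj (by omega)
    | top =>
      rw [mul_assoc]
      exact h.isNormalForm_top_mul hn5 hne hj (by omega)
  rw [mul_assoc]
  exact key.pow_mul a (by ring)

end SallyRel

end NormalForm

lemma sX_eq_X {e m n : ℕ} (i : SallyIdx e m n) : sX e m n i.1 = X i := by
  simp [sX, i.2]

lemma aeval_sX {e n : ℕ} {B : Type*} [CommRing B] [Algebra ℚ B] (f : ℕ → B) (i : ℕ) :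
    aeval (fun j : SallyIdx e 1 n => f j.1) (sX e 1 n i) =
      if i < e ∧ i ≠ 1 ∧ i ≠ n then f i else 0 := by
  unfold sX
  split_ifs <;> simp

lemma sallyRel_of_map_genSet {e n : ℕ} {A : Type*} [CommRing A]
    (φ : MvPolynomial (SallyIdx e 1 n) ℚ →+* A) (hφ : ∀ p ∈ genSet e n, φ p = 0) :
    SallyRel e n (fun i => φ (sX e 1 n i)) := by
  constructor
  all_goals
    intros
    rw [← sub_eq_zero]
    simp only [← map_mul, ← map_pow, ← map_sub]
    apply hφ
    unfold genSet
  · left; left; left; left; left; left; left; exact ⟨_, _, ‹_›, ‹_›, ‹_›, rfl⟩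
  · left; left; left; left; left; left; right; exact ⟨_, ‹_›, rfl⟩
  · left; left; left; left; left; right; exact ⟨_, ‹_›, rfl⟩
  · left; left; left; left; right; rfl
  · left; left; left; right; exact ⟨_, ‹_›, rfl⟩
  · left; left; right; exact ⟨_, ‹_›, rfl⟩
  · left; right; rfl
  · right; left; rfl
  · right; right; rfl

/-- The weight of a monomial of `R(e,m,n)`, that is, the exponent of its image in `ℚ[t]`. -/
def sallyWeight {e m n : ℕ} (u : SallyIdx e m n →₀ ℕ) : ℕ :=
  u.sum fun i c => c * (e + i.1)

lemma aeval_monomial_eq_X_pow {e m n : ℕ} (u : SallyIdx e m n →₀ ℕ) :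
    aeval (fun i : SallyIdx e m n => (Polynomial.X : Polynomial ℚ) ^ (e + i.1))
      (monomial u (1 : ℚ)) = Polynomial.X ^ sallyWeight u := by
  simp [aeval_monomial, sallyWeight, Finsupp.prod, Finsupp.sum, ← pow_mul,
    Finset.prod_pow_eq_pow_sum, mul_comm]

lemma isNormalForm_monomial {e n : ℕ} {A : Type*} [CommRing A]
    (φ : MvPolynomial (SallyIdx e 1 n) ℚ →+* A)
    (h : SallyRel e n (fun i => φ (sX e 1 n i))) (hn5 : 5 ≤ n) (hne : n + 4 ≤ e)
    (u : SallyIdx e 1 n →₀ ℕ) :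
    IsNormalForm e n (fun i => φ (sX e 1 n i)) (sallyWeight u) (φ (monomial u 1)) := by
  have step : ∀ (v : SallyIdx e 1 n →₀ ℕ) (i : SallyIdx e 1 n) (k : ℕ),
      IsNormalForm e n (fun i => φ (sX e 1 n i)) (sallyWeight v) (φ (monomial v 1)) →
      IsNormalForm e n (fun i => φ (sX e 1 n i)) (sallyWeight (Finsupp.single i k + v))
        (φ (monomial (Finsupp.single i k + v) 1)) := by
    intro v i k hv
    induction k with
    | zero => simpa using hv
    | succ k ih =>
      have hm : monomial (Finsupp.single i (k + 1) + v) (1 : ℚ) =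
          monomial (Finsupp.single i k + v) 1 * sX e 1 n i.1 := by
        rw [sX_eq_X, X, monomial_mul, Finsupp.single_add, add_right_comm, mul_one]
      have hw : sallyWeight (Finsupp.single i (k + 1) + v) =
          sallyWeight (Finsupp.single i k + v) + (e + i.1) := by
        simp only [sallyWeight]
        rw [Finsupp.sum_add_index' (by simp) (by intros; ring),
          Finsupp.sum_add_index' (by simp) (by intros; ring),
          Finsupp.sum_single_index (by simp), Finsupp.sum_single_index (by simp)]
        ring
      rw [hm, hw, map_mul]
      exact h.isNormalForm_mul_var hn5 hne ih i.2
  induction u using Finsupp.induction with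
  | zero =>
    simpa [sallyWeight] using (IsApery.one.isNormalForm (e := e) (n := n)
      (y := fun i => φ (sX e 1 n i)) (W := 0) (by simp))
  | single_add i k v _ _ hv => exact step v i k hv

lemma sallyIdeal_le_span {e n : ℕ} (hn5 : 5 ≤ n) (hne : n + 4 ≤ e) :
    sallyIdeal e 1 n ≤ Ideal.span (genSet e n) := by
  set I := Ideal.span (genSet e n)
  set φ : MvPolynomial (SallyIdx e 1 n) ℚ →ₐ[ℚ] _ := Ideal.Quotient.mkₐ ℚ I
  have hrel := sallyRel_of_map_genSet φ.toRingHom fun p hp =>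
    Ideal.Quotient.eq_zero_iff_mem.2 (Ideal.subset_span hp)
  have hnf : ∀ u, IsNormalForm e n (fun i => φ (sX e 1 n i)) (sallyWeight u)
      (φ (monomial u 1)) := isNormalForm_monomial φ.toRingHom hrel hn5 hne
  classical
  let g : ℕ → MvPolynomial (SallyIdx e 1 n) ℚ ⧸ I := fun W =>
    if hW : ∃ u : SallyIdx e 1 n →₀ ℕ, sallyWeight u = W then φ (monomial hW.choose 1) else 0
  have hg : ∀ u, g (sallyWeight u) = φ (monomial u 1) := fun u => by
    have hu : ∃ v : SallyIdx e 1 n →₀ ℕ, sallyWeight v = sallyWeight u := ⟨u, rfl⟩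
    simp only [g, dif_pos hu]
    have := hnf hu.choose
    rw [hu.choose_spec] at this
    exact this.unique (hnf u) hn5 hne
  let ψ : Polynomial ℚ →ₗ[ℚ] MvPolynomial (SallyIdx e 1 n) ℚ ⧸ I :=
    (Polynomial.basisMonomials ℚ).constr ℚ g
  have hψ : ψ ∘ₗ (aeval (fun i : SallyIdx e 1 n =>
      (Polynomial.X : Polynomial ℚ) ^ (e + i.1))).toLinearMap = φ.toLinearMap := by
    refine (basisMonomials _ ℚ).ext fun u => ?_
    simp only [coe_basisMonomials, LinearMap.comp_apply, AlgHom.toLinearMap_apply]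
    rw [aeval_monomial_eq_X_pow, ← hg, ← Polynomial.monomial_one_right_eq_X_pow]
    simpa using (Polynomial.basisMonomials ℚ).constr_basis ℚ g (sallyWeight u)
  intro f hf
  have hf0 : aeval (fun i : SallyIdx e 1 n =>
    (Polynomial.X : Polynomial ℚ) ^ (e + i.1)) f = 0 := hf
  have := LinearMap.congr_fun hψ f
  simp only [LinearMap.comp_apply, AlgHom.toLinearMap_apply, hf0, map_zero] at this
  exact Ideal.Quotient.eq_zero_iff_mem.1 this.symm

lemma genSet_subset_sallyIdeal {e n : ℕ} (hn5 : 5 ≤ n) (hne : n + 4 ≤ e) :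
    genSet e n ⊆ sallyIdeal e 1 n := by
  intro p hp
  change aeval (fun i : SallyIdx e 1 n => (Polynomial.X : Polynomial ℚ) ^ (e + i.1)) p = 0
  have hX : ∀ i, i < e ∧ i ≠ 1 ∧ i ≠ n → aeval (fun i : SallyIdx e 1 n =>
      (Polynomial.X : Polynomial ℚ) ^ (e + i.1)) (sX e 1 n i) = Polynomial.X ^ (e + i) :=
    fun i hi => by
      rw [aeval_sX fun i => (Polynomial.X : Polynomial ℚ) ^ (e + i), if_pos hi]
  rcases hp with (((((((⟨i, j, hi, hj, hij, rfl⟩ | ⟨i, hi, rfl⟩) | ⟨i, hi, rfl⟩) | rfl) |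
    ⟨i, hi, rfl⟩) | ⟨i, hi, rfl⟩) | rfl) | (rfl | rfl))
  all_goals
    simp only [map_sub, map_mul, map_pow]
    repeat rw [hX _ (by omega)]
    rw [sub_eq_zero]
    simp only [← pow_mul, ← pow_add]
    congr 1
    omega

/-- The generator of `genSet e n` in which `x_c x_d` is the monomial with the two closest
indices. -/
noncomputable def innerGen (e n c d : ℕ) : MvPolynomial (SallyIdx e 1 n) ℚ :=
  if c = 2 then
    if d = e - 2 then sX e 1 n 0 ^ 3 - sX e 1 n 2 * sX e 1 n (e - 2)
    else sX e 1 n 0 * sX e 1 n (d + 2) - sX e 1 n 2 * sX e 1 n d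
  else if d = e - 1 then
    if c = n + 1 then
      sX e 1 n 0 * sX e 1 n 2 * sX e 1 n (n - 2) - sX e 1 n (n + 1) * sX e 1 n (e - 1)
    else sX e 1 n 0 ^ 2 * sX e 1 n (c - 1) - sX e 1 n c * sX e 1 n (e - 1)
  else if d = n - 1 then
    if c = 3 then sX e 1 n (n - 1) * sX e 1 n 3 - sX e 1 n (n + 2) * sX e 1 n 0
    else sX e 1 n (n - 1) * sX e 1 n c - sX e 1 n (n + 1) * sX e 1 n (c - 2)
  else if c = n + 1 then
    if d = e - 2 then sX e 1 n 0 ^ 2 * sX e 1 n (n - 1) - sX e 1 n (n + 1) * sX e 1 n (e - 2)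
    else sX e 1 n (n + 1) * sX e 1 n d - sX e 1 n (n - 1) * sX e 1 n (d + 2)
  else sX e 1 n (c - 1) * sX e 1 n (d + 1) - sX e 1 n c * sX e 1 n d

lemma exists_innerGen_eq {e n : ℕ} (hn5 : 5 ≤ n) (hne : n + 4 ≤ e)
    {p : MvPolynomial (SallyIdx e 1 n) ℚ} (hp : p ∈ genSet e n) :
    ∃ c d, (2 ≤ c ∧ c ≤ d ∧ d < e ∧ c ≠ n ∧ d ≠ n ∧ (c = 2 → d ≠ n - 2 ∧ d ≠ e - 1)) ∧
      p = innerGen e n c d := by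
  unfold innerGen
  rcases hp with (((((((⟨i, j, hi, hj, hij, rfl⟩ | ⟨i, hi, rfl⟩) | ⟨i, hi, rfl⟩) | rfl) |
    ⟨i, hi, rfl⟩) | ⟨i, hi, rfl⟩) | rfl) | (rfl | rfl))
  · refine ⟨i + 1, j, by omega, ?_⟩
    rw [if_neg (by omega), if_neg (by omega), if_neg (by omega), if_neg (by omega)]
    rfl
  · refine ⟨i + 1, e - 1, by omega, ?_⟩
    rw [if_neg (by omega), if_pos rfl, if_neg (by omega)]
    rfl
  · refine ⟨2, i, by omega, ?_⟩
    rw [if_pos rfl, if_neg (by omega)]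
  · refine ⟨2, e - 2, by omega, ?_⟩
    rw [if_pos rfl, if_pos rfl]
  · refine ⟨n + 1, n + 1 + i, by omega, ?_⟩
    rw [if_neg (by omega), if_neg (by omega), if_neg (by omega), if_pos rfl, if_neg (by omega),
      show n + 1 + i + 2 = n + 3 + i by omega]
  · refine ⟨n - 1 - i, n - 1, by omega, ?_⟩
    rw [if_neg (by omega), if_neg (by omega), if_pos rfl, if_neg (by omega),
      show n - 1 - i - 2 = n - 3 - i by omega]
  · refine ⟨3, n - 1, by omega, ?_⟩
    rw [if_neg (by omega), if_neg (by omega), if_pos rfl, if_pos rfl]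
  · refine ⟨n + 1, e - 2, by omega, ?_⟩
    rw [if_neg (by omega), if_neg (by omega), if_neg (by omega), if_pos rfl, if_pos rfl]
  · refine ⟨n + 1, e - 1, by omega, ?_⟩
    rw [if_neg (by omega), if_pos rfl, if_pos rfl]

/-- The algebra map `x_i ↦ t^(2e+i)` for `i ≥ a`, which kills the variables `x_i` with `i < a`. -/
noncomputable def truncMap (e n a : ℕ) : MvPolynomial (SallyIdx e 1 n) ℚ →ₐ[ℚ] Polynomial ℚ :=
  aeval fun i => if a ≤ i.1 then (Polynomial.X : Polynomial ℚ) ^ (2 * e + i.1) else 0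

lemma truncMap_sX {e n a i : ℕ} : truncMap e n a (sX e 1 n i) =
    if (i < e ∧ i ≠ 1 ∧ i ≠ n) ∧ a ≤ i then (Polynomial.X : Polynomial ℚ) ^ (2 * e + i) else 0 := by
  rw [truncMap, aeval_sX fun i => if a ≤ i then (Polynomial.X : Polynomial ℚ) ^ (2 * e + i) else 0]
  split_ifs <;> simp_all

lemma truncMap_mul {e n a i j : ℕ} (hi : i < e ∧ i ≠ 1 ∧ i ≠ n) (hj : j < e ∧ j ≠ 1 ∧ j ≠ n) :
    truncMap e n a (sX e 1 n i) * truncMap e n a (sX e 1 n j) =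
      Polynomial.X ^ (4 * e) * if a ≤ i ∧ a ≤ j then Polynomial.X ^ (i + j) else 0 := by
  rw [truncMap_sX, truncMap_sX]
  by_cases h1 : a ≤ i <;> by_cases h2 : a ≤ j <;> simp [h1, h2, hi, hj]
  ring

/-- The map `truncMap e n a` followed by taking the coefficient of `t^(4e+a+b)` detects the
generator `innerGen e n a b` and annihilates the others. -/
lemma truncMap_innerGen {e n : ℕ} (hn5 : 5 ≤ n) (hne : n + 4 ≤ e) {a b c d : ℕ}
    (hc : 2 ≤ c ∧ c ≤ d ∧ d < e ∧ c ≠ n ∧ d ≠ n ∧ (c = 2 → d ≠ n - 2 ∧ d ≠ e - 1))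
    (ha : 2 ≤ a ∧ a ≤ b ∧ b < e ∧ a ≠ n ∧ b ≠ n) :
    ∃ h : Polynomial ℚ, truncMap e n a (innerGen e n c d) = Polynomial.X ^ (4 * e) * h ∧
      (h.coeff (a + b) ≠ 0 ↔ c = a ∧ d = b) := by
  have h0 : truncMap e n a (sX e 1 n 0) = 0 := by
    rw [truncMap_sX, if_neg (by omega)]
  unfold innerGen
  split_ifs
  all_goals
    simp only [map_sub, map_mul, map_pow, h0, zero_mul, mul_zero, ne_eq, OfNat.ofNat_ne_zero,
      not_false_eq_true, zero_pow]
    repeat rw [truncMap_mul (by omega) (by omega)]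
    simp only [← mul_sub, zero_sub, sub_zero, ← mul_neg]
    refine ⟨_, rfl, ?_⟩
    simp only [Polynomial.coeff_sub, Polynomial.coeff_neg, apply_ite (Polynomial.coeff · (a + b)),
      Polynomial.coeff_X_pow, Polynomial.coeff_zero]
    split_ifs <;> simp <;> omega

lemma coeff_truncMap_mul {e n a s : ℕ} (hs : s < 2 * e) (r : MvPolynomial (SallyIdx e 1 n) ℚ)
    (h : Polynomial ℚ) :
    (truncMap e n a r * h).coeff s = constantCoeff r * h.coeff s := by
  have : ∃ q, truncMap e n a r = Polynomial.C (constantCoeff r) + Polynomial.X ^ (2 * e) * q := by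
    induction r using MvPolynomial.induction_on with
    | C x => exact ⟨0, by simp [truncMap]⟩
    | add p q hp hq =>
      obtain ⟨p', hp⟩ := hp
      obtain ⟨q', hq⟩ := hq
      exact ⟨p' + q', by rw [map_add, hp, hq]; simp; ring⟩
    | mul_X p i _ =>
      refine ⟨truncMap e n a p * if a ≤ i.1 then Polynomial.X ^ i.1 else 0, ?_⟩
      rw [map_mul, truncMap, aeval_X]
      split_ifs <;> simp
      ring
  obtain ⟨q, hq⟩ := this
  rw [hq, add_mul, Polynomial.coeff_add, Polynomial.coeff_C_mul, mul_assoc,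
    Polynomial.coeff_X_pow_mul', if_neg (by omega), add_zero]

lemma innerGen_notMem_span {e n : ℕ} (hn5 : 5 ≤ n) (hne : n + 4 ≤ e) {a b : ℕ}
    (hab : 2 ≤ a ∧ a ≤ b ∧ b < e ∧ a ≠ n ∧ b ≠ n ∧ (a = 2 → b ≠ n - 2 ∧ b ≠ e - 1))
    {G' : Set (MvPolynomial (SallyIdx e 1 n) ℚ)} (hG' : G' ⊆ genSet e n)
    (hmem : innerGen e n a b ∉ G') : innerGen e n a b ∉ Ideal.span G' := by
  have hab' : 2 ≤ a ∧ a ≤ b ∧ b < e ∧ a ≠ n ∧ b ≠ n := by omega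
  have key : ∀ p ∈ Ideal.span G', ∃ h : Polynomial ℚ,
      truncMap e n a p = Polynomial.X ^ (4 * e) * h ∧ h.coeff (a + b) = 0 := by
    intro p hp
    induction hp using Submodule.span_induction with
    | mem p hp =>
      obtain ⟨c, d, hcd, rfl⟩ := exists_innerGen_eq hn5 hne (hG' hp)
      obtain ⟨h, h1, h2⟩ := truncMap_innerGen hn5 hne hcd hab'
      refine ⟨h, h1, ?_⟩
      by_contra h3
      obtain ⟨rfl, rfl⟩ := h2.1 h3
      exact hmem hp
    | zero => exact ⟨0, by simp, by simp⟩
    | add p q _ _ hp hq =>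
      obtain ⟨p', hp, hp'⟩ := hp
      obtain ⟨q', hq, hq'⟩ := hq
      exact ⟨p' + q', by rw [map_add, hp, hq, mul_add], by simp [hp', hq']⟩
    | smul r p _ hp =>
      obtain ⟨p', hp, hp'⟩ := hp
      exact ⟨truncMap e n a r * p', by rw [smul_eq_mul, map_mul, hp, mul_left_comm],
        by rw [coeff_truncMap_mul (by omega), hp', mul_zero]⟩
  intro hin
  obtain ⟨h, h1, h2⟩ := key _ hin
  obtain ⟨h', h1', h2'⟩ := truncMap_innerGen hn5 hne hab hab'
  have : h = h' := mul_left_cancel₀ (pow_ne_zero _ Polynomial.X_ne_zero) (h1.symm.trans h1')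
  exact h2'.2 ⟨rfl, rfl⟩ (this ▸ h2)

theorem stmt3 (e n : ℕ) (he : 10 ≤ e) (hn5 : 5 ≤ n) (hne : n ≤ e - 4) :
    Ideal.span (genSet e n) = sallyIdeal e 1 n ∧
    ∀ G' : Set (MvPolynomial (SallyIdx e 1 n) ℚ), G' ⊂ genSet e n →
      Ideal.span G' ≠ sallyIdeal e 1 n := by
  have hne' : n + 4 ≤ e := by omega
  refine ⟨le_antisymm (Ideal.span_le.2 (genSet_subset_sallyIdeal hn5 hne')) (sallyIdeal_le_span hn5 hne'),
    fun G' hG' hspan => ?_⟩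
  obtain ⟨p, hp, hpG'⟩ := Set.exists_of_ssubset hG'
  have hmem := genSet_subset_sallyIdeal hn5 hne' hp
  obtain ⟨a, b, hab, rfl⟩ := exists_innerGen_eq hn5 hne' hp
  apply innerGen_notMem_span hn5 hne' hab hG'.subset hpG'
  rwa [hspan]
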